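/- Let L be a finite lattice. The number of saturated transfer systems on L equals the number of cosaturated transfer systems on the order dual lattice Lᵒᵈ. -/

import Mathlib

/-- A transfer system on a lattice `L`: a set of pairs `(x, y)` with `x ≤ y`,
containing all identity pairs, closed under composition and restriction. -/
def IsLatticeTransferSystem {L : Type*} [Lattice L] (T : Set (L × L)) : Prop :=
  (∀ p ∈ T, p.1 ≤ p.2) ∧
  (∀ x : L, (x, x) ∈ T) ∧
  (∀ x y z : L, (x, y) ∈ T → (y, z) ∈ T → (x, z) ∈ T) ∧
  (∀ x y z : L, (x, y) ∈ T → z ≤ y → (x ⊓ z, z) ∈ T)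

/-- The transfer system on a lattice generated by a set `S` of pairs. -/
def genLTS {L : Type*} [Lattice L] (S : Set (L × L)) : Set (L × L) :=
  ⋂₀ {T | IsLatticeTransferSystem T ∧ S ⊆ T}

/-- A transfer system on a lattice is saturated if its pairs satisfy two-out-of-three. -/
def IsSaturatedLTS {L : Type*} [Lattice L] (T : Set (L × L)) : Prop :=
  ∀ x y z : L, x ≤ y → y ≤ z →
    (((x, y) ∈ T ∧ (y, z) ∈ T) → (x, z) ∈ T) ∧
    (((x, y) ∈ T ∧ (x, z) ∈ T) → (y, z) ∈ T) ∧
    (((y, z) ∈ T ∧ (x, z) ∈ T) → (x, y) ∈ T)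

/-- A transfer system on a lattice with top element is cosaturated if it is generated
by pairs of the form `(x, ⊤)`. -/
def IsCosaturatedLTS {L : Type*} [Lattice L] [OrderTop L] (T : Set (L × L)) : Prop :=
  ∃ S : Set (L × L), (∀ p ∈ S, p.2 = ⊤) ∧ genLTS S = T

theorem InfClosed.exists_isLeast_of_finite {L : Type*} [Lattice L] [Finite L] {s : Set L}
    (hs : InfClosed s) (hne : s.Nonempty) : ∃ a, IsLeast s a := by
  obtain ⟨m, hm⟩ := s.toFinite.exists_minimal hne
  exact ⟨m, hm.prop, fun b hb =>
    (hm.le_of_le (hs hm.prop hb) inf_le_left).trans inf_le_right⟩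

theorem SupClosed.exists_isGreatest_of_finite {L : Type*} [Lattice L] [Finite L] {s : Set L}
    (hs : SupClosed s) (hne : s.Nonempty) : ∃ a, IsGreatest s a := by
  obtain ⟨m, hm⟩ := s.toFinite.exists_maximal hne
  exact ⟨m, hm.prop, fun b hb =>
    le_sup_right.trans (hm.le_of_ge (hs hm.prop hb) le_sup_left)⟩

/-- The elements that are not the target of any nonidentity pair of `T`. -/
def minimalTargets {L : Type*} (T : Set (L × L)) : Set L :=
  {j | ∀ x, (x, j) ∈ T → x = j}

/-- The pairs `x ≤ y` such that `x` and `y` lie above the same elements of `J`. -/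
def pairsWithSameLower {L : Type*} [Lattice L] (J : Set L) : Set (L × L) :=
  {p | p.1 ≤ p.2 ∧ ∀ j ∈ J, j ≤ p.2 → j ≤ p.1}

/-- The restrictions of the pairs `(m, ⊤)` with `m ∈ M`. -/
def restrictionPairs {L : Type*} [Lattice L] (M : Set L) : Set (L × L) :=
  {p | ∃ m ∈ M, p.1 = m ⊓ p.2}

section Saturated

variable {L : Type*} [Lattice L]

theorem isLatticeTransferSystem_pairsWithSameLower (J : Set L) :
    IsLatticeTransferSystem (pairsWithSameLower J) :=
  ⟨fun _ hp => hp.1, fun _ => ⟨le_rfl, fun _ _ h => h⟩,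
    fun _ _ _ hxy hyz => ⟨hxy.1.trans hyz.1, fun j hj h => hxy.2 j hj (hyz.2 j hj h)⟩,
    fun _ _ _ hxy hzy => ⟨inf_le_right, fun j hj h => le_inf (hxy.2 j hj (h.trans hzy)) h⟩⟩

theorem isSaturatedLTS_pairsWithSameLower (J : Set L) :
    IsSaturatedLTS (pairsWithSameLower J) := fun _ _ _ hxy hyz =>
  ⟨fun h => ⟨hxy.trans hyz, fun j hj hjz => h.1.2 j hj (h.2.2 j hj hjz)⟩,
    fun h => ⟨hyz, fun j hj hjz => (h.2.2 j hj hjz).trans hxy⟩,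
    fun h => ⟨hxy, fun j hj hjy => h.2.2 j hj (hjy.trans hyz)⟩⟩

theorem IsLatticeTransferSystem.le_of_mem_minimalTargets {T : Set (L × L)}
    (hT : IsLatticeTransferSystem T) {x y j : L} (hxy : (x, y) ∈ T)
    (hj : j ∈ minimalTargets T) (hjy : j ≤ y) : j ≤ x :=
  inf_eq_right.1 (hj _ (hT.2.2.2 x y j hxy hjy))

theorem IsLatticeTransferSystem.bot_mem_minimalTargets [OrderBot L] {T : Set (L × L)}
    (hT : IsLatticeTransferSystem T) : ⊥ ∈ minimalTargets T :=
  fun _ hx => le_bot_iff.1 (hT.1 _ hx)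

theorem IsLatticeTransferSystem.supClosed_minimalTargets {T : Set (L × L)}
    (hT : IsLatticeTransferSystem T) : SupClosed (minimalTargets T) :=
  fun _ hi _ hj _ hx => (hT.1 _ hx).antisymm
    (sup_le (hT.le_of_mem_minimalTargets hx hi le_sup_left)
      (hT.le_of_mem_minimalTargets hx hj le_sup_right))

theorem IsLatticeTransferSystem.exists_mem_minimalTargets [Finite L] {T : Set (L × L)}
    (hT : IsLatticeTransferSystem T) (y : L) : ∃ k ∈ minimalTargets T, (k, y) ∈ T := by
  have hs : InfClosed {x | (x, y) ∈ T} := fun a ha b hb =>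
    hT.2.2.1 _ _ _ (hT.2.2.2 a y b ha (hT.1 _ hb)) hb
  obtain ⟨k, hk, hle⟩ := hs.exists_isLeast_of_finite ⟨y, hT.2.1 y⟩
  exact ⟨k, fun x hx => (hT.1 _ hx).antisymm (hle (hT.2.2.1 _ _ _ hx hk)), hk⟩

theorem pairsWithSameLower_minimalTargets [Finite L] {T : Set (L × L)}
    (hT : IsLatticeTransferSystem T) (hsat : IsSaturatedLTS T) :
    pairsWithSameLower (minimalTargets T) = T := by
  ext ⟨x, y⟩
  refine ⟨fun ⟨hxy, h⟩ => ?_, fun h => ⟨hT.1 _ h, fun j hj hjy =>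
    hT.le_of_mem_minimalTargets h hj hjy⟩⟩
  obtain ⟨k, hk, hky⟩ := hT.exists_mem_minimalTargets y
  have hkx : k ≤ x := h k hk (hT.1 _ hky)
  have hkx' := hT.2.2.2 k y x hky hxy
  rw [inf_eq_left.2 hkx] at hkx'
  exact (hsat k x y hkx hxy).2.1 ⟨hkx', hky⟩

theorem minimalTargets_pairsWithSameLower [Finite L] [OrderBot L] {J : Set L}
    (hbot : ⊥ ∈ J) (hJ : SupClosed J) : minimalTargets (pairsWithSameLower J) = J := by
  ext y
  refine ⟨fun hy => ?_, fun hy x hx => hx.1.antisymm (hx.2 y hy le_rfl)⟩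
  have hs : SupClosed {j | j ∈ J ∧ j ≤ y} := fun a ha b hb =>
    ⟨hJ ha.1 hb.1, sup_le ha.2 hb.2⟩
  obtain ⟨k, hk, hge⟩ := hs.exists_isGreatest_of_finite ⟨⊥, hbot, bot_le⟩
  rw [← hy k ⟨hk.2, fun j hj hjy => hge ⟨hj, hjy⟩⟩]
  exact hk.1

/-- Saturated transfer systems on a finite lattice correspond to the join-closed subsets
containing the bottom element. -/
def saturatedEquivSupClosed [Finite L] [OrderBot L] :
    {T : Set (L × L) // IsLatticeTransferSystem T ∧ IsSaturatedLTS T} ≃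
      {J : Set L // ⊥ ∈ J ∧ SupClosed J} where
  toFun T := ⟨minimalTargets T.1, T.2.1.bot_mem_minimalTargets, T.2.1.supClosed_minimalTargets⟩
  invFun J := ⟨pairsWithSameLower J.1, isLatticeTransferSystem_pairsWithSameLower J.1,
    isSaturatedLTS_pairsWithSameLower J.1⟩
  left_inv T := Subtype.ext (pairsWithSameLower_minimalTargets T.2.1 T.2.2)
  right_inv J := Subtype.ext (minimalTargets_pairsWithSameLower J.2.1 J.2.2)

end Saturated

section Cosaturated

variable {L : Type*} [Lattice L] [OrderTop L]

theorem isLatticeTransferSystem_restrictionPairs {M : Set L} (htop : ⊤ ∈ M)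
    (hM : InfClosed M) : IsLatticeTransferSystem (restrictionPairs M) := by
  refine ⟨?_, fun x => ⟨⊤, htop, (top_inf_eq x).symm⟩, ?_, ?_⟩
  · rintro ⟨x, y⟩ ⟨m, -, h⟩
    exact h.trans_le inf_le_right
  · rintro x y z ⟨m, hm, hx : x = m ⊓ y⟩ ⟨n, hn, hy : y = n ⊓ z⟩
    exact ⟨m ⊓ n, hM hm hn, show x = m ⊓ n ⊓ z by rw [hx, hy, inf_assoc]⟩
  · rintro x y z ⟨m, hm, hx : x = m ⊓ y⟩ hzy
    exact ⟨m, hm, show x ⊓ z = m ⊓ z by rw [hx, inf_assoc, inf_eq_right.2 hzy]⟩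

theorem IsLatticeTransferSystem.restrictionPairs_subset {T : Set (L × L)}
    (hT : IsLatticeTransferSystem T) {M : Set L} (hM : ∀ m ∈ M, (m, ⊤) ∈ T) :
    restrictionPairs M ⊆ T := by
  rintro ⟨x, y⟩ ⟨m, hm, hx : x = m ⊓ y⟩
  rw [hx]
  exact hT.2.2.2 m ⊤ y (hM m hm) le_top

theorem mk_top_mem_restrictionPairs {M : Set L} {m : L} :
    (m, ⊤) ∈ restrictionPairs M ↔ m ∈ M := by
  simp [restrictionPairs]

theorem isCosaturatedLTS_restrictionPairs {M : Set L} (htop : ⊤ ∈ M) (hM : InfClosed M) :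
    IsCosaturatedLTS (restrictionPairs M) := by
  refine ⟨{p | p.1 ∈ M ∧ p.2 = ⊤}, fun p hp => hp.2, Set.Subset.antisymm ?_ ?_⟩
  · refine Set.sInter_subset_of_mem ⟨isLatticeTransferSystem_restrictionPairs htop hM, ?_⟩
    rintro ⟨m, y⟩ ⟨hm, rfl : y = ⊤⟩
    exact mk_top_mem_restrictionPairs.2 hm
  · exact Set.subset_sInter fun T hT =>
      hT.1.restrictionPairs_subset fun m hm => hT.2 ⟨hm, rfl⟩

theorem IsLatticeTransferSystem.infClosed_setOf_mk_top_mem {T : Set (L × L)}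
    (hT : IsLatticeTransferSystem T) : InfClosed {m | (m, ⊤) ∈ T} :=
  fun a ha b hb => hT.2.2.1 _ _ _ (hT.2.2.2 a ⊤ b ha le_top) hb

theorem restrictionPairs_setOf_mk_top_mem {T : Set (L × L)}
    (hT : IsLatticeTransferSystem T) (hcosat : IsCosaturatedLTS T) :
    restrictionPairs {m | (m, ⊤) ∈ T} = T := by
  refine (hT.restrictionPairs_subset fun _ => id).antisymm ?_
  obtain ⟨S, hS, hST⟩ := hcosat
  have hsub : S ⊆ T := hST ▸ Set.subset_sInter fun _ hU => hU.2
  refine hST.symm.subset.trans (Set.sInter_subset_of_mem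
    ⟨isLatticeTransferSystem_restrictionPairs (hT.2.1 ⊤) hT.infClosed_setOf_mk_top_mem, ?_⟩)
  rintro ⟨m, y⟩ hp
  obtain rfl : y = ⊤ := hS _ hp
  exact mk_top_mem_restrictionPairs.2 (hsub hp)

/-- Cosaturated transfer systems correspond to the meet-closed subsets containing the top
element. -/
def cosaturatedEquivInfClosed :
    {T : Set (L × L) // IsLatticeTransferSystem T ∧ IsCosaturatedLTS T} ≃
      {M : Set L // ⊤ ∈ M ∧ InfClosed M} where
  toFun T := ⟨{m | (m, ⊤) ∈ T.1}, T.2.1.2.1 ⊤, T.2.1.infClosed_setOf_mk_top_mem⟩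
  invFun M := ⟨restrictionPairs M.1, isLatticeTransferSystem_restrictionPairs M.2.1 M.2.2,
    isCosaturatedLTS_restrictionPairs M.2.1 M.2.2⟩
  left_inv T := Subtype.ext (restrictionPairs_setOf_mk_top_mem T.2.1 T.2.2)
  right_inv _ := Subtype.ext (Set.ext fun _ => mk_top_mem_restrictionPairs)

end Cosaturated

/-- Join-closed subsets containing the bottom element are the meet-closed subsets of the order
dual containing the top element. -/
def supClosedEquivInfClosedDual {L : Type*} [Lattice L] [OrderBot L] :
    {J : Set L // ⊥ ∈ J ∧ SupClosed J} ≃ {M : Set Lᵒᵈ // ⊤ ∈ M ∧ InfClosed M} where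
  toFun J := ⟨OrderDual.ofDual ⁻¹' J.1, J.2.1, J.2.2.dual⟩
  invFun M := ⟨OrderDual.toDual ⁻¹' M.1, M.2.1, M.2.2.dual⟩
  left_inv _ := rfl
  right_inv _ := rfl

/-- For a finite lattice `L`, the number of saturated transfer systems on `L` equals
the number of cosaturated transfer systems on the order dual lattice `Lᵒᵈ`. -/
theorem card_saturated_eq_card_cosaturated_dual
    {L : Type*} [Lattice L] [Finite L] [BoundedOrder L] :
    Nat.card {T : Set (L × L) // IsLatticeTransferSystem T ∧ IsSaturatedLTS T} =
    Nat.card {T : Set (Lᵒᵈ × Lᵒᵈ) // IsLatticeTransferSystem T ∧ IsCosaturatedLTS T} :=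
  Nat.card_congr ((saturatedEquivSupClosed.trans supClosedEquivInfClosedDual).trans
    cosaturatedEquivInfClosed.symm)
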